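/- The conjugation map γ : r ↦ brb⁻¹ restricts to a well-defined k-algebra automorphism of R; in particular ab and cb lie in R, with ab = 2(xy − Λx⁻¹y⁻¹) − (x + Λx⁻¹)(y − y⁻¹) and cb = (xy − Λx⁻¹y⁻¹)(y − y⁻¹) + 2(x + Λx⁻¹), and γ(h) = (ab)b⁻², γ(g) = (cb)b⁻², γ⁻¹(h) = b⁻²(ab), γ⁻¹(g) = b⁻²(cb) all lie in R. -/

import Mathlib

/-- `D`, together with the distinguished nonzero elements `x`, `y` satisfying
`x * y = q • (y * x)`, is the `q`-division ring `k_q(x,y)`: the Ore division ring of fractions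
of the quantum plane `k_q[x,y]`.  The quantum plane sits inside `D` as the `k`-subalgebra
generated by `x` and `y`; linear independence of the monomials `yⁱxʲ` says that this subalgebra
really is the quantum plane, and `exists_frac` says that `D` is its ring of (left) fractions. -/
structure IsQDivisionRing (k : Type*) [Field k] (D : Type*) [DivisionRing D] [Algebra k D]
    (q : k) (x y : D) : Prop where
  x_ne_zero : x ≠ 0
  y_ne_zero : y ≠ 0
  rel : x * y = algebraMap k D q * (y * x)
  monomials_linearIndependent :
    LinearIndependent k fun p : ℕ × ℕ => y ^ p.1 * x ^ p.2
  exists_frac : ∀ d : D, ∃ s t : D, s ∈ Algebra.adjoin k ({x, y} : Set D) ∧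
    t ∈ Algebra.adjoin k ({x, y} : Set D) ∧ t ≠ 0 ∧ d = t⁻¹ * s

/-- `MemDivisionClosure k s d` says that `d` lies in the division subring of `D`
generated over `k` by the set `s`. -/
inductive MemDivisionClosure (k : Type*) [Field k] {D : Type*} [DivisionRing D] [Algebra k D]
    (s : Set D) : D → Prop
  | mem {a : D} : a ∈ s → MemDivisionClosure k s a
  | scalar (c : k) : MemDivisionClosure k s (algebraMap k D c)
  | add {a b : D} : MemDivisionClosure k s a → MemDivisionClosure k s b →
      MemDivisionClosure k s (a + b)
  | neg {a : D} : MemDivisionClosure k s a → MemDivisionClosure k s (-a)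
  | mul {a b : D} : MemDivisionClosure k s a → MemDivisionClosure k s b →
      MemDivisionClosure k s (a * b)
  | inv {a : D} : MemDivisionClosure k s a → MemDivisionClosure k s a⁻¹

set_option linter.unusedSimpArgs false

namespace IsQDivisionRing

variable {k : Type*} [Field k] {D : Type*} [DivisionRing D] [Algebra k D] {q : k} {x y : D}

theorem mul_eq_smul (hD : IsQDivisionRing k D q x y) : x * y = q • (y * x) := by
  rw [hD.rel, Algebra.smul_def]

theorem mul_pow_eq_smul (hD : IsQDivisionRing k D q x y) (i : ℕ) :
    x * y ^ i = q ^ i • (y ^ i * x) := by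
  induction i with
  | zero => simp
  | succ i ih =>
    rw [pow_succ, ← mul_assoc, ih, smul_mul_assoc, mul_assoc, hD.mul_eq_smul, mul_smul_comm,
      smul_smul, mul_assoc, pow_succ]

theorem mem_span_monomials (hD : IsQDivisionRing k D q x y) {s : D}
    (hs : s ∈ Algebra.adjoin k ({x, y} : Set D)) :
    s ∈ Submodule.span k (Set.range fun p : ℕ × ℕ => y ^ p.1 * x ^ p.2) := by
  set M := Submodule.span k (Set.range fun p : ℕ × ℕ => y ^ p.1 * x ^ p.2) with hM
  have mono (i j : ℕ) : y ^ i * x ^ j ∈ M := Submodule.subset_span ⟨(i, j), rfl⟩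
  suffices H : ∀ m ∈ M, s * m ∈ M by simpa using H 1 (by simpa using mono 0 0)
  induction hs using Algebra.adjoin_induction with
  | mem s hs =>
    intro m hm
    induction hm using Submodule.span_induction with
    | mem m hm =>
      obtain ⟨⟨i, j⟩, rfl⟩ := hm
      rcases hs with rfl | rfl
      · change s * (y ^ i * s ^ j) ∈ M
        rw [← mul_assoc, hD.mul_pow_eq_smul, smul_mul_assoc, mul_assoc, ← pow_succ']
        exact M.smul_mem _ (mono _ _)
      · change s * (s ^ i * x ^ j) ∈ M
        rw [← mul_assoc, ← pow_succ']
        exact mono _ _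
    | zero => simp
    | add m n _ _ hm hn => rw [mul_add]; exact M.add_mem hm hn
    | smul r m _ hm => rw [mul_smul_comm]; exact M.smul_mem _ hm
  | algebraMap r => intro m hm; rw [← Algebra.smul_def]; exact M.smul_mem _ hm
  | add s t _ _ hs ht => intro m hm; rw [add_mul]; exact M.add_mem (hs m hm) (ht m hm)
  | mul s t _ _ hs ht => intro m hm; rw [mul_assoc]; exact hs _ (ht m hm)

/-- `y` is not invertible in the quantum plane. -/
theorem mul_ne_one (hD : IsQDivisionRing k D q x y) {s : D}
    (hs : s ∈ Algebra.adjoin k ({x, y} : Set D)) : y * s ≠ 1 := by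
  intro h1
  refine hD.monomials_linearIndependent.notMem_span_image (s := {p | p.1 ≠ 0}) (x := (0, 0))
    (by simp) ?_
  simp only [pow_zero, mul_one]
  rw [← h1]
  have hs' := hD.mem_span_monomials hs
  clear h1 hs
  induction hs' using Submodule.span_induction with
  | mem m hm =>
    obtain ⟨⟨i, j⟩, rfl⟩ := hm
    exact Submodule.subset_span ⟨(i + 1, j), by simp, by simp [pow_succ', mul_assoc]⟩
  | zero => simp
  | add m n _ _ hm hn => rw [mul_add]; exact Submodule.add_mem _ hm hn
  | smul r m _ hm => rw [mul_smul_comm]; exact Submodule.smul_mem _ _ hm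

theorem add_inv_ne_zero (hD : IsQDivisionRing k D q x y) : y + y⁻¹ ≠ 0 := by
  intro h0
  have hy : y ∈ Algebra.adjoin k ({x, y} : Set D) := Algebra.subset_adjoin (by simp)
  refine hD.mul_ne_one (neg_mem hy) ?_
  have := congrArg (y * ·) h0
  simp only [mul_add, mul_inv_cancel₀ hD.y_ne_zero, mul_zero] at this
  rw [mul_neg, eq_comm, ← sub_eq_zero, sub_neg_eq_add, add_comm, this]

end IsQDivisionRing

/-- The commutation relations between `x`, `y`, `z = y⁻¹` and `w = Λx⁻¹`. -/
structure QuantumRelations {k : Type*} [Field k] {D : Type*} [Ring D] [Algebra k D]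
    (q : k) (x y z w : D) : Prop where
  yz : y * z = 1
  zy : z * y = 1
  xy : x * y = q • (y * x)
  xz : x * z = q⁻¹ • (z * x)
  wy : w * y = q⁻¹ • (y * w)
  wz : w * z = q • (z * w)
  wx : w * x = z - q⁻¹ • y
  xw : x * w = q⁻¹ • z - y

namespace QuantumRelations

section Ring

variable {k : Type*} [Field k] {D : Type*} [Ring D] [Algebra k D] {q : k} {x y z w : D}

theorem yz_assoc (H : QuantumRelations q x y z w) (r : D) : y * (z * r) = r := by
  rw [← mul_assoc, H.yz, one_mul]

theorem zy_assoc (H : QuantumRelations q x y z w) (r : D) : z * (y * r) = r := by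
  rw [← mul_assoc, H.zy, one_mul]

theorem xy_assoc (H : QuantumRelations q x y z w) (r : D) :
    x * (y * r) = q • (y * (x * r)) := by
  rw [← mul_assoc, H.xy, smul_mul_assoc, mul_assoc]

theorem xz_assoc (H : QuantumRelations q x y z w) (r : D) :
    x * (z * r) = q⁻¹ • (z * (x * r)) := by
  rw [← mul_assoc, H.xz, smul_mul_assoc, mul_assoc]

theorem wy_assoc (H : QuantumRelations q x y z w) (r : D) :
    w * (y * r) = q⁻¹ • (y * (w * r)) := by
  rw [← mul_assoc, H.wy, smul_mul_assoc, mul_assoc]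

theorem wz_assoc (H : QuantumRelations q x y z w) (r : D) :
    w * (z * r) = q • (z * (w * r)) := by
  rw [← mul_assoc, H.wz, smul_mul_assoc, mul_assoc]

theorem wx_assoc (H : QuantumRelations q x y z w) (r : D) :
    w * (x * r) = z * r - q⁻¹ • (y * r) := by
  rw [← mul_assoc, H.wx, sub_mul, smul_mul_assoc]

theorem xw_assoc (H : QuantumRelations q x y z w) (r : D) :
    x * (w * r) = q⁻¹ • (z * r) - y * r := by
  rw [← mul_assoc, H.xw, sub_mul, smul_mul_assoc]

theorem conj_a (H : QuantumRelations q x y z w) (hq : q ≠ 0) :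
    (y + z) * ((x - w) * (y + z)) =
      (x - w) * ((2 * q⁻¹ + 2 * q) • 1 + q • ((y - z) * (y - z))) +
        (q⁻¹ - q) • ((x * y + w * z) * (y - z)) := by
  simp only [mul_add, add_mul, mul_sub, sub_mul, mul_assoc, mul_smul_comm, smul_mul_assoc, smul_add,
    smul_sub, smul_smul, mul_one, one_mul, H.yz, H.zy, H.xy, H.xz, H.wy, H.wz, H.wx, H.xw, H.yz_assoc,
    H.zy_assoc, H.xy_assoc, H.xz_assoc, H.wy_assoc, H.wz_assoc, H.wx_assoc, H.xw_assoc]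
  match_scalars <;> field_simp <;> ring

theorem conj_c (H : QuantumRelations q x y z w) (hq : q ≠ 0) :
    (y + z) * ((x * y + w * z) * (y + z)) =
      (x * y + w * z) * ((2 * q⁻¹ + 2 * q) • 1 + q • ((y - z) * (y - z)) +
        (q⁻¹ - q) • ((y - z) * (y - z))) + (q⁻¹ - q) • ((x - w) * (y - z)) := by
  simp only [mul_add, add_mul, mul_sub, sub_mul, mul_assoc, mul_smul_comm, smul_mul_assoc, smul_add,
    smul_sub, smul_smul, mul_one, one_mul, H.yz, H.zy, H.xy, H.xz, H.wy, H.wz, H.wx, H.xw, H.yz_assoc,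
    H.zy_assoc, H.xy_assoc, H.xz_assoc, H.wy_assoc, H.wz_assoc, H.wx_assoc, H.xw_assoc]
  match_scalars <;> field_simp <;> ring

end Ring

variable {k : Type*} [Field k] {D : Type*} [DivisionRing D] [Algebra k D] {q : k} {x y z w : D}

theorem sub_mul_eq (H : QuantumRelations q x y z w) (hq : q ≠ 0) (hb : y + z ≠ 0) :
    (y - z) * ((y + z)⁻¹ * (x * y + w * z) * ((y + z)⁻¹ * (x - w)) - 1) =
      (q ^ 2)⁻¹ • ((y + z)⁻¹ * (x * y + w * z) * ((y + z)⁻¹ * (x * y + w * z))) -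
        q • ((y + z)⁻¹ * (x - w) * ((y + z)⁻¹ * (x - w))) := by
  set b := y + z with hbd
  set a := x - w with had
  set c := x * y + w * z with hcd
  have htb : b * (y - z) = (y - z) * b := by
    simp only [hbd, mul_add, add_mul, mul_sub, sub_mul, mul_assoc, mul_smul_comm, smul_mul_assoc, smul_add,
    smul_sub, smul_smul, mul_one, one_mul, H.yz, H.zy, H.xy, H.xz, H.wy, H.wz, H.wx, H.xw, H.yz_assoc,
    H.zy_assoc, H.xy_assoc, H.xz_assoc, H.wy_assoc, H.wz_assoc, H.wx_assoc, H.xw_assoc]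
    module
  have h1 : (y - z) * c + q • a = q • (y * y * x - z * z * w) := by
    simp only [had, hcd, mul_add, add_mul, mul_sub, sub_mul, mul_assoc, mul_smul_comm, smul_mul_assoc, smul_add,
    smul_sub, smul_smul, mul_one, one_mul, H.yz, H.zy, H.xy, H.xz, H.wy, H.wz, H.wx, H.xw, H.yz_assoc,
    H.zy_assoc, H.xy_assoc, H.xz_assoc, H.wy_assoc, H.wz_assoc, H.wx_assoc, H.xw_assoc]
    match_scalars <;> field_simp <;> ring
  have h2 : y * a - q⁻¹ • c = -(b * w) := by
    simp only [hbd, had, hcd, mul_add, add_mul, mul_sub, sub_mul, mul_assoc, mul_smul_comm, smul_mul_assoc, smul_add,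
    smul_sub, smul_smul, mul_one, one_mul, H.yz, H.zy, H.xy, H.xz, H.wy, H.wz, H.wx, H.xw, H.yz_assoc,
    H.zy_assoc, H.xy_assoc, H.xz_assoc, H.wy_assoc, H.wz_assoc, H.wx_assoc, H.xw_assoc]
    match_scalars <;> field_simp <;> ring
  have h3 : z * a + q⁻¹ • c = b * x := by
    simp only [hbd, had, hcd, mul_add, add_mul, mul_sub, sub_mul, mul_assoc, mul_smul_comm, smul_mul_assoc, smul_add,
    smul_sub, smul_smul, mul_one, one_mul, H.yz, H.zy, H.xy, H.xz, H.wy, H.wz, H.wx, H.xw, H.yz_assoc,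
    H.zy_assoc, H.xy_assoc, H.xz_assoc, H.wy_assoc, H.wz_assoc, H.wx_assoc, H.xw_assoc]
    match_scalars <;> field_simp <;> ring
  have key : (y - z) * (c * (b⁻¹ * a)) - (q ^ 2)⁻¹ • (c * (b⁻¹ * c)) + q • (a * (b⁻¹ * a)) =
      (y - z) * b := by
    have comm_y : b⁻¹ * y = y * b⁻¹ :=
      (Commute.inv_left₀ (show b * y = y * b by simp only [hbd, add_mul, mul_add, H.yz, H.zy])).eq
    have comm_z : b⁻¹ * z = z * b⁻¹ :=
      (Commute.inv_left₀ (show b * z = z * b by simp only [hbd, add_mul, mul_add, H.yz, H.zy])).eq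
    calc _ = ((y - z) * c + q • a) * (b⁻¹ * a) - (q ^ 2)⁻¹ • (c * (b⁻¹ * c)) := by
          simp only [add_mul, mul_assoc, smul_mul_assoc]; abel
      _ = y * (x * (b⁻¹ * (y * a - q⁻¹ • c))) - z * (w * (b⁻¹ * (z * a + q⁻¹ • c))) := by
          rw [h1, mul_sub b⁻¹ (y * a), mul_add b⁻¹ (z * a), ← mul_assoc b⁻¹ y, ← mul_assoc b⁻¹ z,
            comm_y, comm_z]
          have hc : c = q • (y * x + z * w) := by
            rw [hcd, H.xy, H.wz, smul_add]
          have e : c * (b⁻¹ * c) = q • (y * (x * (b⁻¹ * c)) + z * (w * (b⁻¹ * c))) := by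
            nth_rewrite 1 [hc]
            rw [smul_mul_assoc, add_mul, mul_assoc, mul_assoc]
          rw [e]
          simp only [mul_sub, sub_mul, mul_add, mul_assoc, H.xy_assoc, H.wz_assoc, mul_smul_comm,
            smul_mul_assoc, smul_sub, smul_add, smul_smul]
          match_scalars <;> field_simp
      _ = _ := by
          rw [h2, h3, mul_neg, ← mul_assoc b⁻¹, ← mul_assoc b⁻¹, inv_mul_cancel₀ hb]
          simp only [hbd, one_mul, mul_neg, H.xw, H.wx]
          simp only [mul_add, add_mul, mul_sub, sub_mul, mul_assoc, mul_smul_comm, smul_mul_assoc, smul_add,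
    smul_sub, smul_smul, mul_one, one_mul, H.yz, H.zy, H.xy, H.xz, H.wy, H.wz, H.wx, H.xw, H.yz_assoc,
    H.zy_assoc, H.xy_assoc, H.xz_assoc, H.wy_assoc, H.wz_assoc, H.wx_assoc, H.xw_assoc]
          module
  apply mul_left_cancel₀ hb
  rw [← mul_assoc b, htb, mul_assoc]
  have cancel (r : D) : b * (b⁻¹ * r) = r := mul_inv_cancel_left₀ hb r
  simp only [mul_sub, mul_smul_comm, mul_assoc, cancel, mul_one]
  rw [sub_eq_sub_iff_add_eq_add, ← sub_eq_zero]
  rw [← sub_eq_zero] at key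
  rw [← key]
  simp only [sub_mul, mul_sub]
  abel

end QuantumRelations

namespace IsQDivisionRing

variable {k : Type*} [Field k] {D : Type*} [DivisionRing D] [Algebra k D] {q : k} {x y : D}

theorem quantumRelations (hD : IsQDivisionRing k D q x y) (hq : q ≠ 0) :
    QuantumRelations q x y y⁻¹ ((y⁻¹ - q⁻¹ • y) * x⁻¹) := by
  have hx := hD.x_ne_zero
  have hy := hD.y_ne_zero
  have yz : y * y⁻¹ = 1 := mul_inv_cancel₀ hy
  have zy : y⁻¹ * y = 1 := inv_mul_cancel₀ hy
  have hxy := hD.mul_eq_smul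
  have hxz : x * y⁻¹ = q⁻¹ • (y⁻¹ * x) := by
    apply mul_right_cancel₀ hy
    rw [mul_assoc, zy, smul_mul_assoc, mul_assoc, hxy, mul_smul_comm, smul_smul,
      inv_mul_cancel₀ hq, ← mul_assoc, zy, one_smul, one_mul, mul_one]
  have hvy : x⁻¹ * y = q⁻¹ • (y * x⁻¹) := by
    apply mul_left_cancel₀ hx
    rw [mul_inv_cancel_left₀ hx, mul_smul_comm, ← mul_assoc, hxy, smul_mul_assoc, smul_smul,
      inv_mul_cancel₀ hq, one_smul, mul_inv_cancel_right₀ hx]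
  have hvz : x⁻¹ * y⁻¹ = q • (y⁻¹ * x⁻¹) := by
    apply mul_left_cancel₀ hx
    rw [mul_inv_cancel_left₀ hx, mul_smul_comm, ← mul_assoc, hxz, smul_mul_assoc, smul_smul,
      mul_inv_cancel₀ hq, one_smul, mul_inv_cancel_right₀ hx]
  refine ⟨yz, zy, hxy, hxz, ?_, ?_, inv_mul_cancel_right₀ hx _, ?_⟩
  · rw [mul_assoc, hvy, mul_smul_comm, ← mul_assoc, ← mul_assoc, mul_sub, sub_mul, mul_smul_comm,
      smul_mul_assoc, yz, zy]
  · rw [mul_assoc, hvz, mul_smul_comm, ← mul_assoc, ← mul_assoc, mul_sub, sub_mul, mul_smul_comm,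
      smul_mul_assoc, yz, zy]
  · rw [← mul_assoc, mul_sub, hxz, mul_smul_comm, hxy, smul_smul, inv_mul_cancel₀ hq, one_smul,
      sub_mul, smul_mul_assoc, mul_inv_cancel_right₀ hx, mul_inv_cancel_right₀ hx]

theorem mul_ne_one_of_relations (hD : IsQDivisionRing k D q x y) (hq : q ≠ 0) {z w : D}
    (H : QuantumRelations q x y z w) (hb : y + z ≠ 0) :
    (y + z)⁻¹ * (x * y + w * z) * ((y + z)⁻¹ * (x - w)) ≠ 1 := by
  intro h1
  have hy : y ∈ Algebra.adjoin k ({x, y} : Set D) := Algebra.subset_adjoin (by simp)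
  have hx : x ∈ Algebra.adjoin k ({x, y} : Set D) := Algebra.subset_adjoin (by simp)
  set p := q • y + q⁻¹ • z with hp
  set m := q⁻¹ • y + q • z with hm
  have hpx : p * x * (y + z)⁻¹ = x := by
    rw [mul_inv_eq_iff_eq_mul₀ hb]
    simp only [hp, mul_add, add_mul, mul_sub, sub_mul, mul_assoc, mul_smul_comm, smul_mul_assoc, smul_add,
    smul_sub, smul_smul, mul_one, one_mul, H.yz, H.zy, H.xy, H.xz, H.wy, H.wz, H.wx, H.xw, H.yz_assoc,
    H.zy_assoc, H.xy_assoc, H.xz_assoc, H.wy_assoc, H.wz_assoc, H.wx_assoc, H.xw_assoc]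
  have hmw : m * w * (y + z)⁻¹ = w := by
    rw [mul_inv_eq_iff_eq_mul₀ hb]
    simp only [hm, mul_add, add_mul, mul_sub, sub_mul, mul_assoc, mul_smul_comm, smul_mul_assoc, smul_add,
    smul_sub, smul_smul, mul_one, one_mul, H.yz, H.zy, H.xy, H.xz, H.wy, H.wz, H.wx, H.xw, H.yz_assoc,
    H.zy_assoc, H.xy_assoc, H.xz_assoc, H.wy_assoc, H.wz_assoc, H.wx_assoc, H.xw_assoc]
  have hc : m * p * (x * y + w * z) * (y + z)⁻¹ = q • (y * m * x + z * p * w) := by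
    have e : m * p * (x * y + w * z) = q • (y * m * (p * x) + z * p * (m * w)) := by
      simp only [hp, hm, mul_add, add_mul, mul_sub, sub_mul, mul_assoc, mul_smul_comm, smul_mul_assoc, smul_add,
    smul_sub, smul_smul, mul_one, one_mul, H.yz, H.zy, H.xy, H.xz, H.wy, H.wz, H.wx, H.xw, H.yz_assoc,
    H.zy_assoc, H.xy_assoc, H.xz_assoc, H.wy_assoc, H.wz_assoc, H.wx_assoc, H.xw_assoc]
      match_scalars <;> field_simp <;> ring
    rw [e, smul_mul_assoc, add_mul, mul_assoc (y * m), mul_assoc (z * p), hpx, hmw]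
  have h2 : (x * y + w * z) * (y + z)⁻¹ * (x - w) = y + z := by
    have := congrArg ((y + z) * ·) h1
    simpa only [← mul_assoc, mul_inv_cancel₀ hb, one_mul, mul_one] using this
  have h3 : q • ((y * m * x + z * p * w) * (x - w)) = m * p * (y + z) := by
    rw [← smul_mul_assoc, ← hc]
    conv_rhs => rw [← h2]
    simp only [mul_assoc]
  have h4 := congrArg (fun r => y * (y * (y * (y * (r * (x * x)))))) h3
  set B := y * y + 1 with hB
  set P := q • (y * y) + q⁻¹ • 1 with hP
  set M := q⁻¹ • (y * y) + q • 1 with hM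
  set S := q • (y * y * y * M * (x * x * x * x)) -
    q • (y * y * M * (q⁻¹ • 1 - y * y) * (x * x)) +
    q • (P * (1 - q⁻¹ • (y * y)) * (x * x)) - P * M * B * (x * x) with hS
  set T := y * ((q ^ 3 - 1 - (q⁻¹) ^ 2) • 1 + ((q⁻¹) ^ 3 - q ^ 2 - 1) • (y * y) +
    q⁻¹ • (y * y * (y * y))) with hT
  have e : y * (S - T) = q • 1 := by
    rw [← sub_eq_zero] at h4 ⊢
    rw [← h4]
    simp only [hp, hm, hB, hP, hM, hS, hT, mul_add, add_mul, mul_sub, sub_mul, mul_assoc, mul_smul_comm, smul_mul_assoc, smul_add,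
    smul_sub, smul_smul, mul_one, one_mul, H.yz, H.zy, H.xy, H.xz, H.wy, H.wz, H.wx, H.xw, H.yz_assoc,
    H.zy_assoc, H.xy_assoc, H.xz_assoc, H.wy_assoc, H.wz_assoc, H.wx_assoc, H.xw_assoc]
    match_scalars <;> field_simp <;> ring
  refine hD.mul_ne_one (s := q⁻¹ • (S - T)) ?_ (by
    rw [mul_smul_comm, e, smul_smul, inv_mul_cancel₀ hq, one_smul])
  have hu := mul_mem hy hy
  have hv := mul_mem hx hx
  have one := one_mem (Algebra.adjoin k ({x, y} : Set D))
  have sm (r : k) {d : D} (hd : d ∈ Algebra.adjoin k ({x, y} : Set D)) :=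
    Subalgebra.smul_mem _ hd r
  have hBm := add_mem hu one
  have hPm := add_mem (sm q hu) (sm q⁻¹ one)
  have hMm := add_mem (sm q⁻¹ hu) (sm q one)
  have hSm : S ∈ Algebra.adjoin k ({x, y} : Set D) :=
    sub_mem (add_mem (sub_mem (sm _ (mul_mem (mul_mem (mul_mem hu hy) hMm)
      (mul_mem (mul_mem hv hx) hx)))
      (sm _ (mul_mem (mul_mem (mul_mem hu hMm) (sub_mem (sm _ one) hu)) hv)))
      (sm _ (mul_mem (mul_mem hPm (sub_mem one (sm _ hu))) hv)))
      (mul_mem (mul_mem (mul_mem hPm hMm) hBm) hv)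
  have hTm : T ∈ Algebra.adjoin k ({x, y} : Set D) :=
    mul_mem hy (add_mem (add_mem (sm _ one) (sm _ hu)) (sm _ (mul_mem hu hu)))
  exact sm _ (sub_mem hSm hTm)

end IsQDivisionRing

namespace MemDivisionClosure

variable {k : Type*} [Field k] {D : Type*} [DivisionRing D] [Algebra k D] {s : Set D}

theorem sub {a b : D} (ha : MemDivisionClosure k s a) (hb : MemDivisionClosure k s b) :
    MemDivisionClosure k s (a - b) := by
  rw [sub_eq_add_neg]; exact ha.add hb.neg

theorem one : MemDivisionClosure k s (1 : D) := by
  simpa using scalar (k := k) (s := s) 1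

theorem smul {a : D} (r : k) (ha : MemDivisionClosure k s a) : MemDivisionClosure k s (r • a) := by
  rw [Algebra.smul_def]; exact (scalar r).mul ha

/-- If conjugation by `b` maps `s` into its division closure, it preserves that closure. -/
theorem conj {b : D} (hb : b ≠ 0) (hs : ∀ r ∈ s, MemDivisionClosure k s (b * r * b⁻¹)) {r : D}
    (hr : MemDivisionClosure k s r) : MemDivisionClosure k s (b * r * b⁻¹) := by
  induction hr with
  | mem hr => exact hs _ hr
  | scalar c =>
    rw [← Algebra.commutes, mul_inv_cancel_right₀ hb]
    exact scalar c
  | add _ _ h₁ h₂ => rw [mul_add, add_mul]; exact h₁.add h₂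
  | neg _ h => rw [mul_neg, neg_mul]; exact h.neg
  | @mul r₁ r₂ _ _ h₁ h₂ =>
    have e : b * (r₁ * r₂) * b⁻¹ = b * r₁ * b⁻¹ * (b * r₂ * b⁻¹) := by
      simp only [mul_assoc, inv_mul_cancel_left₀ hb]
    rw [e]; exact h₁.mul h₂
  | @inv r _ h =>
    have e : b * r⁻¹ * b⁻¹ = (b * r * b⁻¹)⁻¹ := by
      simp only [mul_inv_rev, inv_inv, mul_assoc]
    rw [e]; exact h.inv

end MemDivisionClosure

/-- The conjugation map `γ : r ↦ brb⁻¹` restricts to a well-defined automorphism of `R` (both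
it and its inverse `r ↦ b⁻¹rb` map `R` into `R`); in particular `ab` and `cb` lie in `R`, with
`ab = 2(xy − Λx⁻¹y⁻¹) − (x + Λx⁻¹)(y − y⁻¹)` and
`cb = (xy − Λx⁻¹y⁻¹)(y − y⁻¹) + 2(x + Λx⁻¹)`, and
`γ(h) = (ab)b⁻²`, `γ(g) = (cb)b⁻²`, `γ⁻¹(h) = b⁻²(ab)`, `γ⁻¹(g) = b⁻²(cb)` all lie in `R`. -/
theorem stmt5 (k : Type*) [Field k] [CharZero k] (q : k) (hq : q ≠ 0)
    (D : Type*) [DivisionRing D] [Algebra k D] (x y : D)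
    (hD : IsQDivisionRing k D q x y) :
    let Q : D := algebraMap k D q
    let Λ : D := y⁻¹ - Q⁻¹ * y
    let a : D := x - Λ * x⁻¹
    let b : D := y + y⁻¹
    let c : D := x * y + Λ * (x⁻¹ * y⁻¹)
    let h : D := b⁻¹ * a
    let g : D := b⁻¹ * c
    let R : Set D := {r : D | MemDivisionClosure k ({h, g} : Set D) r}
    a * b = 2 * (x * y - Λ * (x⁻¹ * y⁻¹)) - (x + Λ * x⁻¹) * (y - y⁻¹) ∧
    c * b = (x * y - Λ * (x⁻¹ * y⁻¹)) * (y - y⁻¹) + 2 * (x + Λ * x⁻¹) ∧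
    a * b ∈ R ∧ c * b ∈ R ∧
    b * h * b⁻¹ = (a * b) * (b ^ 2)⁻¹ ∧ b * h * b⁻¹ ∈ R ∧
    b * g * b⁻¹ = (c * b) * (b ^ 2)⁻¹ ∧ b * g * b⁻¹ ∈ R ∧
    b⁻¹ * h * b = (b ^ 2)⁻¹ * (a * b) ∧ b⁻¹ * h * b ∈ R ∧
    b⁻¹ * g * b = (b ^ 2)⁻¹ * (c * b) ∧ b⁻¹ * g * b ∈ R ∧
    (∀ r : D, r ∈ R → b * r * b⁻¹ ∈ R ∧ b⁻¹ * r * b ∈ R) := by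
  intro Q Λ a b c h g R
  have hΛ : Λ = y⁻¹ - q⁻¹ • y := by
    simp only [Λ, Q, ← map_inv₀, Algebra.smul_def]
  have H := hD.quantumRelations hq
  have hb : b ≠ 0 := hD.add_inv_ne_zero
  have hw : Λ * (x⁻¹ * y⁻¹) = Λ * x⁻¹ * y⁻¹ := (mul_assoc _ _ _).symm
  rw [← hΛ] at H
  have hc : c = x * y + Λ * x⁻¹ * y⁻¹ := by simp only [c, hw]
  clear_value Λ
  set t : D := y - y⁻¹ with ht
  have hhR : h ∈ R := .mem (by simp)
  have hgR : g ∈ R := .mem (by simp)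
  have htR : t ∈ R := by
    have hne : g * h - 1 ≠ 0 := by
      rw [sub_ne_zero]
      simpa only [g, h, hc] using hD.mul_ne_one_of_relations hq H hb
    have e : t = ((q ^ 2)⁻¹ • (g * g) - q • (h * h)) * (g * h - 1)⁻¹ := by
      rw [eq_mul_inv_iff_mul_eq₀ hne]
      simpa only [g, h, hc] using H.sub_mul_eq hq hb
    rw [e]
    exact (((hgR.mul hgR).smul _).sub ((hhR.mul hhR).smul _)).mul ((hgR.mul hhR).sub .one).inv
  have habR : a * b ∈ R := by
    have e : a * b = h * ((2 * q⁻¹ + 2 * q) • 1 + q • (t * t)) + (q⁻¹ - q) • (g * t) := by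
      apply mul_left_cancel₀ hb
      rw [mul_add b (h * _), mul_smul_comm]
      simp only [h, g, ← mul_assoc, mul_inv_cancel₀ hb, one_mul]
      simpa only [hc, ← mul_assoc] using H.conj_a hq
    rw [e]
    exact (hhR.mul ((MemDivisionClosure.one.smul _).add ((htR.mul htR).smul _))).add
      ((hgR.mul htR).smul _)
  have hcbR : c * b ∈ R := by
    have e : c * b = g * ((2 * q⁻¹ + 2 * q) • 1 + q • (t * t) + (q⁻¹ - q) • (t * t)) +
        (q⁻¹ - q) • (h * t) := by
      apply mul_left_cancel₀ hb
      rw [mul_add b (g * _), mul_smul_comm]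
      simp only [h, g, ← mul_assoc, mul_inv_cancel₀ hb, one_mul]
      simpa only [hc, ← mul_assoc] using H.conj_c hq
    rw [e]
    exact (hgR.mul (((MemDivisionClosure.one.smul _).add ((htR.mul htR).smul _)).add
      ((htR.mul htR).smul _))).add ((hhR.mul htR).smul _)
  have hb2R : b ^ 2 ∈ R := by
    have e : b ^ 2 = t * t + (4 : k) • 1 := by
      simp only [b, ht, pow_two, mul_add, add_mul, mul_sub, sub_mul, H.yz, H.zy]
      module
    rw [e]
    exact (htR.mul htR).add (MemDivisionClosure.one.smul _)
  have conj_eq (r : D) : b * (b⁻¹ * r) * b⁻¹ = r * b * (b ^ 2)⁻¹ := by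
    rw [mul_inv_cancel_left₀ hb, pow_two, mul_inv_rev, ← mul_assoc, mul_inv_cancel_right₀ hb]
  have inv_conj_eq (r : D) : b⁻¹ * (b⁻¹ * r) * b = (b ^ 2)⁻¹ * (r * b) := by
    simp only [pow_two, mul_inv_rev, mul_assoc]
  have h₁ : b * h * b⁻¹ ∈ R := by rw [conj_eq]; exact habR.mul hb2R.inv
  have h₂ : b * g * b⁻¹ ∈ R := by rw [conj_eq]; exact hcbR.mul hb2R.inv
  have h₃ : b⁻¹ * h * b ∈ R := by rw [inv_conj_eq]; exact hb2R.inv.mul habR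
  have h₄ : b⁻¹ * g * b ∈ R := by rw [inv_conj_eq]; exact hb2R.inv.mul hcbR
  refine ⟨?_, ?_, habR, hcbR, conj_eq a, h₁, conj_eq c, h₂, inv_conj_eq a, h₃, inv_conj_eq c, h₄,
    fun r hr => ⟨hr.conj hb ?_, ?_⟩⟩
  · simp only [a, b, ht, hw, two_mul, mul_add, add_mul, mul_sub, sub_mul]
    abel
  · simp only [hc, b, ht, hw, two_mul, mul_add, add_mul, mul_sub, sub_mul,
      mul_inv_cancel_right₀ hD.y_ne_zero, inv_mul_cancel_right₀ hD.y_ne_zero]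
    abel
  · rintro r (rfl | rfl)
    exacts [h₁, h₂]
  · have := hr.conj (inv_ne_zero hb) (by
      rintro r (rfl | rfl)
      · rw [inv_inv]; exact h₃
      · rw [inv_inv]; exact h₄)
    rwa [inv_inv] at this
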